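/- There exists an infinite-dimensional real Banach space X such that (i) whenever f, g ∈ NA(X,ℝ) are linearly independent and 0 < t < 1, the functional t·f + (1−t)·g is not norm-attaining, and (ii) for every closed linear subspace M of X with dim(X/M) = 2 there exist x₁, x₂ in the closed unit ball of X such that π_M(B_X) ∩ S_{X/M} ⊆ {π_M(x₁), π_M(x₂), −π_M(x₁), −π_M(x₂)}, where B_X is the closed unit ball of X and S_{X/M} is the unit sphere of the quotient X/M with the quotient norm. -/

import Mathlib

open Filter Topology Set

universe u

/-- The vector space `E`, renormed by the Minkowski functional of `U`. -/
def GaugeNormed {E : Type u} (_U : Set E) : Type u := E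

namespace GaugeNormed

variable {E : Type u} [NormedAddCommGroup E] [NormedSpace ℝ E] {U : Set E}

noncomputable instance : AddCommGroup (GaugeNormed U) := inferInstanceAs (AddCommGroup E)

noncomputable instance : Module ℝ (GaugeNormed U) := inferInstanceAs (Module ℝ E)

noncomputable instance : Norm (GaugeNormed U) := ⟨fun x => gauge U (show E from x)⟩

/-- The identity map onto the renormed space. -/
def equiv (U : Set E) : E ≃ₗ[ℝ] GaugeNormed U := LinearEquiv.refl ℝ E

theorem norm_equiv (x : E) : ‖equiv U x‖ = gauge U x := rfl

theorem core (hc : Convex ℝ U) (hsymm : ∀ x ∈ U, -x ∈ U) (hb : Bornology.IsBounded U)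
    (h0 : U ∈ 𝓝 0) : NormedSpace.Core ℝ (GaugeNormed U) where
  norm_nonneg x := gauge_nonneg _
  norm_smul r x := by
    have key : ∀ s : ℝ, 0 ≤ s → ∀ y : E, gauge U (s • y) = s * gauge U y := fun s hs y => by
      rw [gauge_smul_of_nonneg hs, smul_eq_mul]
    change gauge U (r • (show E from x)) = |r| * gauge U (show E from x)
    rcases le_total 0 r with hr | hr
    · rw [key r hr, abs_of_nonneg hr]
    · rw [← gauge_neg hsymm, ← neg_smul, key (-r) (by linarith), abs_of_nonpos hr]
  norm_triangle x y := gauge_add_le hc (absorbent_nhds_zero h0) _ _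
  norm_eq_zero_iff x := gauge_eq_zero (absorbent_nhds_zero h0)
    ((NormedSpace.isVonNBounded_iff ℝ).2 hb)

end GaugeNormed

/-- The Minkowski functional of a bounded symmetric convex neighbourhood of zero in a Banach space
is a complete norm. -/
theorem exists_complete_gauge_norm {E : Type u} [NormedAddCommGroup E] [NormedSpace ℝ E]
    [CompleteSpace E] {U : Set E} (hc : Convex ℝ U) (hsymm : ∀ x ∈ U, -x ∈ U)
    (hb : Bornology.IsBounded U) (h0 : U ∈ 𝓝 0) :
    ∃ (X : Type u) (_ : NormedAddCommGroup X) (_ : NormedSpace ℝ X) (_ : CompleteSpace X)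
      (e : E ≃ₗ[ℝ] X), ∀ x, ‖e x‖ = gauge U x := by
  let core := GaugeNormed.core hc hsymm hb h0
  let i1 : NormedAddCommGroup (GaugeNormed U) := NormedAddCommGroup.ofCore core
  let i2 : NormedSpace ℝ (GaugeNormed U) := NormedSpace.ofCore core
  obtain ⟨r, hr, hrU⟩ := Metric.mem_nhds_iff.1 h0
  obtain ⟨R, hR, hUR⟩ := hb.subset_closedBall_lt 0 0
  let e : E ≃ₗ[ℝ] GaugeNormed U := GaugeNormed.equiv U
  have hnorm : ∀ x, ‖e x‖ = gauge U x := fun x => rfl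
  have h1 : ∀ x, ‖e x‖ ≤ r⁻¹ * ‖x‖ := fun x => by
    rw [hnorm, inv_mul_eq_div, le_div_iff₀ hr, mul_comm]
    exact mul_gauge_le_norm hrU
  have h2 : ∀ y, ‖e.symm y‖ ≤ R * ‖y‖ := fun y => by
    have := le_gauge_of_subset_closedBall (absorbent_nhds_zero h0) hR.le hUR (x := e.symm y)
    rw [← hnorm, LinearEquiv.apply_symm_apply, div_le_iff₀ hR] at this
    linarith
  let e' : E ≃L[ℝ] GaugeNormed U := e.toContinuousLinearEquivOfBounds _ _ h1 h2
  exact ⟨GaugeNormed U, i1, i2, (completeSpace_congr (e := e'.toEquiv) e'.isUniformEmbedding).1 ‹_›, e, hnorm⟩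

/-- The Banach space of real null sequences. -/
abbrev NullSeq := ZeroAtInftyContinuousMap ℕ ℝ

namespace NullSeq

theorem abs_apply_le (x : NullSeq) (n : ℕ) : |x n| ≤ ‖x‖ :=
  x.toBCF.norm_coe_le_norm n

theorem norm_le {x : NullSeq} {r : ℝ} (hr : 0 ≤ r) (h : ∀ n, |x n| ≤ r) : ‖x‖ ≤ r :=
  (BoundedContinuousFunction.norm_le (f := x.toBCF) hr).2 h

theorem tendsto_zero (x : NullSeq) : Tendsto x atTop (𝓝 0) := by
  have := x.zero_at_infty'
  rwa [cocompact_eq_cofinite, Nat.cofinite_eq_atTop] at this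

theorem eventually_abs_lt (x : NullSeq) {r : ℝ} (hr : 0 < r) : ∀ᶠ n in atTop, |x n| < r := by
  have := x.tendsto_zero.abs
  rw [abs_zero] at this
  exact this.eventually_lt_const hr

/-- The unit vector supported at `b`. -/
noncomputable def single (b : ℕ) : NullSeq where
  toFun := Pi.single b 1
  continuous_toFun := continuous_of_discreteTopology
  zero_at_infty' := by
    rw [cocompact_eq_cofinite, Nat.cofinite_eq_atTop]
    refine tendsto_const_nhds.congr' ?_
    filter_upwards [eventually_gt_atTop b] with n hn
    simp [hn.ne']

theorem single_apply (b n : ℕ) : single b n = if n = b then 1 else 0 := by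
  change (Pi.single b 1 : ℕ → ℝ) n = _
  rw [Pi.single_apply]

theorem not_finiteDimensional : ¬ FiniteDimensional ℝ NullSeq := by
  intro h
  have hli : LinearIndependent ℝ single := by
    rw [linearIndependent_iff']
    intro s g hg i hi
    let ev : NullSeq →ₗ[ℝ] ℝ :=
      { toFun := fun x => x i, map_add' := fun _ _ => rfl, map_smul' := fun _ _ => rfl }
    have h1 := congrArg ev hg
    rw [map_sum, map_zero] at h1
    simpa [ev, single_apply, hi] using h1
  exact not_finite_iff_infinite.2 inferInstance hli.finite

/-- The functional `x ↦ x j + (-1) ^ s * x k`. -/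
def pairForm (j k s : ℕ) : NullSeq →ₗ[ℝ] ℝ where
  toFun x := x j + (-1) ^ s * x k
  map_add' x y := by simp only [ZeroAtInftyContinuousMap.add_apply]; ring
  map_smul' c x := by
    simp only [ZeroAtInftyContinuousMap.smul_apply, smul_eq_mul, RingHom.id_apply]; ring

theorem pairForm_apply (j k s : ℕ) (x : NullSeq) : pairForm j k s x = x j + (-1) ^ s * x k := rfl

theorem abs_pairForm_le (j k s : ℕ) (x : NullSeq) : |pairForm j k s x| ≤ 2 * ‖x‖ := by
  rw [pairForm_apply]
  refine (abs_add_le _ _).trans ?_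
  rw [abs_mul, abs_pow, abs_neg, abs_one, one_pow, one_mul]
  linarith [x.abs_apply_le j, x.abs_apply_le k]

theorem abs_spread_term_le (n b : ℕ) (x : NullSeq) :
    |if b.unpair.1 = n then (1 / 2 : ℝ) ^ b * x b else 0| ≤ ‖x‖ * (1 / 2 : ℝ) ^ b := by
  split_ifs
  · rw [abs_mul, abs_of_pos (by positivity), mul_comm]
    gcongr
    exact x.abs_apply_le b
  · rw [abs_zero]; positivity

theorem summable_spread (n : ℕ) (x : NullSeq) :
    Summable fun b : ℕ => if b.unpair.1 = n then (1 / 2 : ℝ) ^ b * x b else 0 :=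
  .of_norm_bounded (g := fun b => ‖x‖ * (1 / 2 : ℝ) ^ b) (summable_geometric_two.mul_left ‖x‖)
    fun b => abs_spread_term_le n b x

/-- The functional `x ↦ ∑ 2⁻ᵇ x b`, the sum being over those `b` which code a pair with first
entry `n`. -/
noncomputable def spread (n : ℕ) : NullSeq →ₗ[ℝ] ℝ where
  toFun x := ∑' b : ℕ, if b.unpair.1 = n then (1 / 2 : ℝ) ^ b * x b else 0
  map_add' x y := by
    rw [← (summable_spread n x).tsum_add (summable_spread n y)]
    congr with b
    split_ifs <;> simp [mul_add]
  map_smul' c x := by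
    rw [RingHom.id_apply, smul_eq_mul, ← tsum_mul_left]
    congr with b
    split_ifs <;> simp [mul_left_comm]

theorem abs_spread_le (n : ℕ) (x : NullSeq) : |spread n x| ≤ 2 * ‖x‖ := by
  have := tsum_of_norm_bounded
    (f := fun b : ℕ => if b.unpair.1 = n then (1 / 2 : ℝ) ^ b * x b else 0)
    (summable_geometric_two.mul_left ‖x‖).hasSum fun b => abs_spread_term_le n b x
  rwa [tsum_mul_left, tsum_geometric_two, mul_comm] at this

theorem spread_single (n b : ℕ) :
    spread n (single b) = if b.unpair.1 = n then (1 / 2 : ℝ) ^ b else 0 := by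
  change ∑' i : ℕ, (if i.unpair.1 = n then (1 / 2 : ℝ) ^ i * single b i else 0) = _
  rw [tsum_eq_single b]
  · simp [single_apply]
  · intro i hi
    simp [single_apply, hi]

/-- The pair form coded by `n`; every pair form is coded infinitely often. -/
def codedForm (n : ℕ) : NullSeq →ₗ[ℝ] ℝ :=
  pairForm n.unpair.1.unpair.1 n.unpair.1.unpair.2.unpair.1 n.unpair.1.unpair.2.unpair.2

theorem codedForm_pair (j k s m : ℕ) :
    codedForm (Nat.pair (Nat.pair j (Nat.pair k s)) m) = pairForm j k s := by
  simp [codedForm]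

theorem codedForm_single_eq_zero {n b : ℕ} (h : n < b) : codedForm n (single b) = 0 := by
  have h1 := n.unpair_left_le
  have h2 := n.unpair.1.unpair_left_le
  have h3 := n.unpair.1.unpair_right_le
  have h4 := n.unpair.1.unpair.2.unpair_left_le
  rw [codedForm, pairForm_apply, single_apply, single_apply, if_neg (by omega),
    if_neg (by omega)]
  ring

theorem norm_single_le (b : ℕ) : ‖single b‖ ≤ 1 :=
  norm_le zero_le_one fun n => by rw [single_apply]; split_ifs <;> simp

/-- A small perturbation of the coded form, making the sequence of functionals strongly independent
modulo finitely supported functionals. -/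
noncomputable def form (n : ℕ) : NullSeq →ₗ[ℝ] ℝ := codedForm n + (1 / 2 : ℝ) ^ n • spread n

theorem form_apply (n : ℕ) (x : NullSeq) :
    form n x = codedForm n x + (1 / 2 : ℝ) ^ n * spread n x := rfl

theorem abs_form_le (n : ℕ) (x : NullSeq) : |form n x| ≤ 4 * ‖x‖ := by
  have h1 := abs_pairForm_le n.unpair.1.unpair.1 n.unpair.1.unpair.2.unpair.1
    n.unpair.1.unpair.2.unpair.2 x
  have h2 := abs_spread_le n x
  have h3 : (1 / 2 : ℝ) ^ n ≤ 1 := pow_le_one₀ (by norm_num) (by norm_num)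
  have h4 : (0 : ℝ) < (1 / 2) ^ n := by positivity
  rw [form_apply]
  refine (abs_add_le _ _).trans ?_
  rw [abs_mul, abs_of_pos h4]
  have : (1 / 2 : ℝ) ^ n * |spread n x| ≤ 1 * |spread n x| := by gcongr
  unfold codedForm
  linarith

theorem tendsto_form (j k s : ℕ) (x : NullSeq) :
    Tendsto (fun m => form (Nat.pair (Nat.pair j (Nat.pair k s)) m) x) atTop
      (𝓝 (x j + (-1) ^ s * x k)) := by
  simp only [form_apply, codedForm_pair, pairForm_apply]
  have hp : Tendsto (fun m => Nat.pair (Nat.pair j (Nat.pair k s)) m) atTop atTop :=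
    tendsto_atTop_mono (Nat.right_le_pair _) tendsto_id
  have h1 : Tendsto (fun n => (1 / 2 : ℝ) ^ n * spread n x) atTop (𝓝 0) := by
    refine squeeze_zero_norm (a := fun n => (1 / 2 : ℝ) ^ n * (2 * ‖x‖)) (fun n => ?_) ?_
    · rw [norm_mul, Real.norm_of_nonneg (by positivity)]
      gcongr
      exact abs_spread_le n x
    · simpa using (tendsto_pow_atTop_nhds_zero_of_lt_one (r := (1 / 2 : ℝ)) (by norm_num)
        (by norm_num)).mul_const (2 * ‖x‖)
  simpa using (h1.comp hp).const_add (x j + (-1) ^ s * x k)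

/-- If a weighted sum of the functionals `form n` vanishes on all but finitely many unit vectors,
then all the coefficients are zero. -/
theorem coeff_eq_zero_of_eventually_tsum_eq_zero {d : ℕ → ℝ} {K : ℝ} (hd : ∀ n, |d n| ≤ K)
    (h : ∀ᶠ b in atTop, ∑' n, (1 / 8 : ℝ) ^ n * (d n * form n (single b)) = 0) (k : ℕ) :
    d k = 0 := by
  have hK : 0 ≤ K := (abs_nonneg _).trans (hd 0)
  have hterm : ∀ n b, |(1 / 8 : ℝ) ^ n * (d n * codedForm n (single b))| ≤
      2 * K * (1 / 4) ^ b * (1 / 2) ^ n := fun n b => by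
    rcases lt_or_ge n b with hnb | hnb
    · rw [codedForm_single_eq_zero hnb]
      simp only [mul_zero, abs_zero]
      positivity
    · have h1 : |codedForm n (single b)| ≤ 2 := by
        have := abs_pairForm_le n.unpair.1.unpair.1 n.unpair.1.unpair.2.unpair.1
          n.unpair.1.unpair.2.unpair.2 (single b)
        unfold codedForm
        linarith [norm_single_le b]
      have h2 : (1 / 8 : ℝ) ^ n ≤ (1 / 4) ^ b * (1 / 2) ^ n := by
        rw [show (1 / 8 : ℝ) = 1 / 4 * (1 / 2) by norm_num, mul_pow]
        gcongr ?_ * _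
        exact pow_le_pow_of_le_one (by norm_num) (by norm_num) hnb
      rw [abs_mul, abs_mul, abs_of_pos (by positivity)]
      calc (1 / 8 : ℝ) ^ n * (|d n| * |codedForm n (single b)|)
          ≤ ((1 / 4) ^ b * (1 / 2) ^ n) * (K * 2) := by gcongr; exact hd n
        _ = _ := by ring
  have hsum : ∀ b, Summable fun n => 2 * K * (1 / 4 : ℝ) ^ b * (1 / 2) ^ n := fun b =>
    summable_geometric_two.mul_left _
  have hbound : ∀ᶠ m in atTop, |d k| * (1 / 16) ^ k ≤ 4 * K * (1 / 2) ^ (Nat.pair k m) := by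
    have hp : Tendsto (fun m => Nat.pair k m) atTop atTop :=
      tendsto_atTop_mono (Nat.right_le_pair _) tendsto_id
    filter_upwards [hp.eventually h] with m hm
    set b := Nat.pair k m with hb
    have hspread : HasSum (fun n => (1 / 8 : ℝ) ^ n * (d n * ((1 / 2) ^ n * spread n (single b))))
        ((1 / 8 : ℝ) ^ k * (d k * ((1 / 2) ^ k * (1 / 2) ^ b))) := by
      have := hasSum_single (f := fun n => (1 / 8 : ℝ) ^ n *
        (d n * ((1 / 2) ^ n * spread n (single b)))) k (fun n hn => by
          rw [spread_single, hb, Nat.unpair_pair, if_neg hn.symm]; ring)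
      rwa [spread_single, hb, Nat.unpair_pair, if_pos rfl] at this
    have hcoded := (Summable.of_norm_bounded
      (f := fun n => (1 / 8 : ℝ) ^ n * (d n * codedForm n (single b))) (hsum b)
      fun n => hterm n b).hasSum
    have htot := hcoded.add hspread
    simp only [form_apply] at hm
    have heq := htot.tsum_eq
    simp only [← mul_add] at heq
    rw [hm] at heq
    have hle := tsum_of_norm_bounded
      (f := fun n => (1 / 8 : ℝ) ^ n * (d n * codedForm n (single b))) (hsum b).hasSum
      fun n => hterm n b
    rw [tsum_mul_left, tsum_geometric_two, Real.norm_eq_abs] at hle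
    rw [eq_neg_of_add_eq_zero_left heq.symm, abs_neg, abs_mul, abs_mul,
      abs_of_pos (by positivity : (0 : ℝ) < (1 / 8) ^ k),
      abs_of_pos (by positivity : (0 : ℝ) < (1 / 2) ^ k * (1 / 2) ^ b)] at hle
    have h4 : (1 / 4 : ℝ) ^ b = (1 / 2) ^ b * (1 / 2) ^ b := by rw [← mul_pow]; norm_num
    have h16 : (1 / 16 : ℝ) ^ k = (1 / 8) ^ k * (1 / 2) ^ k := by rw [← mul_pow]; norm_num
    rw [h16]
    refine le_of_mul_le_mul_right ?_ (by positivity : (0 : ℝ) < (1 / 2) ^ b)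
    calc _ = (1 / 8 : ℝ) ^ k * (|d k| * ((1 / 2) ^ k * (1 / 2) ^ b)) := by ring
      _ ≤ _ := hle
      _ = _ := by rw [h4]; ring
  have hlim : Tendsto (fun m => 4 * K * (1 / 2 : ℝ) ^ (Nat.pair k m)) atTop (𝓝 0) := by
    have hp : Tendsto (fun m => Nat.pair k m) atTop atTop :=
      tendsto_atTop_mono (Nat.right_le_pair _) tendsto_id
    simpa using ((tendsto_pow_atTop_nhds_zero_of_lt_one (r := (1 / 2 : ℝ)) (by norm_num)
        (by norm_num)).comp hp).const_mul (4 * K)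
  have hle : |d k| * (1 / 16) ^ k ≤ 0 := ge_of_tendsto hlim hbound
  have hpos : (0 : ℝ) < (1 / 16) ^ k := by positivity
  exact abs_nonpos_iff.1 (nonpos_of_mul_nonpos_left hle hpos)

theorem eq_zero_of_binary_cubic {a b c p p' q q' r r' : ℝ} (ha : a ≠ 0) (hb : b ≠ 0)
    (h30 : a * p ^ 3 + b * q ^ 3 + c * r ^ 3 = 0)
    (h21 : a * (p ^ 2 * p') + b * (q ^ 2 * q') + c * (r ^ 2 * r') = 0)
    (h12 : a * (p * p' ^ 2) + b * (q * q' ^ 2) + c * (r * r' ^ 2) = 0)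
    (h03 : a * p' ^ 3 + b * q' ^ 3 + c * r' ^ 3 = 0) : p * q' = p' * q := by
  have hab : a * b ≠ 0 := mul_ne_zero ha hb
  by_contra hne
  have hD : (p * q' - p' * q) ^ 2 ≠ 0 := pow_ne_zero 2 (sub_ne_zero.2 hne)
  have e1 : (a * b) * ((p * q' - p' * q) ^ 2 * (p * q)) = 0 := by
    have e : (a * p ^ 3 + b * q ^ 3) * (a * (p * p' ^ 2) + b * (q * q' ^ 2)) =
        (a * (p ^ 2 * p') + b * (q ^ 2 * q')) ^ 2 := by
      rw [eq_neg_of_add_eq_zero_left h30, eq_neg_of_add_eq_zero_left h12,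
        eq_neg_of_add_eq_zero_left h21]
      ring
    linear_combination e
  have e2 : (a * b) * ((p * q' - p' * q) ^ 2 * (p' * q')) = 0 := by
    have e : (a * p' ^ 3 + b * q' ^ 3) * (a * (p ^ 2 * p') + b * (q ^ 2 * q')) =
        (a * (p * p' ^ 2) + b * (q * q' ^ 2)) ^ 2 := by
      rw [eq_neg_of_add_eq_zero_left h03, eq_neg_of_add_eq_zero_left h12,
        eq_neg_of_add_eq_zero_left h21]
      ring
    linear_combination e
  have e3 : (a * b) * ((p * q' - p' * q) ^ 2 * (p * q' + p' * q)) = 0 := by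
    have e : (a * p ^ 3 + b * q ^ 3) * (a * p' ^ 3 + b * q' ^ 3) =
        (a * (p ^ 2 * p') + b * (q ^ 2 * q')) * (a * (p * p' ^ 2) + b * (q * q' ^ 2)) := by
      rw [eq_neg_of_add_eq_zero_left h30, eq_neg_of_add_eq_zero_left h03,
        eq_neg_of_add_eq_zero_left h12, eq_neg_of_add_eq_zero_left h21]
      ring
    linear_combination e
  have f1 : p * q = 0 := by simpa [hab, hD] using e1
  have f2 : p' * q' = 0 := by simpa [hab, hD] using e2
  have f3 : p * q' + p' * q = 0 := by
    rcases mul_eq_zero.1 e3 with h | h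
    · exact absurd h hab
    · exact (mul_eq_zero.1 h).resolve_left hD
  exact hD (by linear_combination (p * q' + p' * q) * f3 - 4 * p' * q' * f1)

theorem cubic_relation {x y z : NullSeq} {a b c : ℝ}
    (h : ∀ n, a * form n x ^ 3 + b * form n y ^ 3 + c * form n z ^ 3 = 0) (j k s : ℕ) :
    a * (x j + (-1) ^ s * x k) ^ 3 + b * (y j + (-1) ^ s * y k) ^ 3 +
      c * (z j + (-1) ^ s * z k) ^ 3 = 0 := by
  have ht := ((((tendsto_form j k s x).pow 3).const_mul a).add
    (((tendsto_form j k s y).pow 3).const_mul b)).add (((tendsto_form j k s z).pow 3).const_mul c)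
  simp only [h] at ht
  exact tendsto_nhds_unique ht tendsto_const_nhds

theorem mul_eq_mul_of_cubic_relation {x y z : NullSeq} {a b c : ℝ} (ha : a ≠ 0) (hb : b ≠ 0)
    (h : ∀ n, a * form n x ^ 3 + b * form n y ^ 3 + c * form n z ^ 3 = 0) (j k : ℕ) :
    x j * y k = x k * y j := by
  have h1 := cubic_relation h j j 0
  have h2 := cubic_relation h k k 0
  have h3 := cubic_relation h j k 0
  have h4 := cubic_relation h j k 1
  norm_num at h1 h2 h3 h4
  refine eq_zero_of_binary_cubic (c := c) (r := z j) (r' := z k) ha hb ?_ ?_ ?_ ?_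
  · linear_combination h1 / 8
  · linear_combination h3 / 6 - h4 / 6 - h2 / 24
  · linear_combination h3 / 6 + h4 / 6 - h1 / 24
  · linear_combination h2 / 8

theorem eq_zero_of_forall_form_eq_zero {x : NullSeq} (h : ∀ n, form n x = 0) : x = 0 := by
  ext j
  have ht := tendsto_form j j 0 x
  simp only [h] at ht
  have := tendsto_nhds_unique ht tendsto_const_nhds
  simp at this ⊢
  linarith

/-- The signed distance from a real number to the interval `[-1, 1]`. -/
noncomputable def excess (u : ℝ) : ℝ := u - max (-1) (min 1 u)

theorem excess_sq_le (u : ℝ) {c : ℝ} (h1 : -1 ≤ c) (h2 : c ≤ 1) :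
    excess u ^ 2 ≤ (u - c) ^ 2 := by
  unfold excess
  rcases le_total u 1 with h | h
  · rw [min_eq_right h]
    rcases le_total (-1) u with h' | h'
    · rw [max_eq_right h']; nlinarith [sq_nonneg (u - c)]
    · rw [max_eq_left h']; nlinarith
  · rw [min_eq_left h, max_eq_right (by norm_num)]; nlinarith

theorem excess_eq_zero {u : ℝ} (h : |u| ≤ 1) : excess u = 0 := by
  obtain ⟨h1, h2⟩ := abs_le.1 h
  rw [excess, min_eq_right h2, max_eq_right h1, sub_self]

theorem excess_neg (u : ℝ) : excess (-u) = -excess u := by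
  unfold excess
  grind

theorem excess_mul_self_nonneg (u : ℝ) : 0 ≤ excess u * u := by
  unfold excess
  rcases le_total u 1 with h | h
  · rw [min_eq_right h]
    rcases le_total (-1) u with h' | h'
    · rw [max_eq_right h']; simp
    · rw [max_eq_left h']; nlinarith
  · rw [min_eq_left h, max_eq_right (by norm_num)]; nlinarith

theorem abs_le_one_add_abs_excess (u : ℝ) : |u| ≤ 1 + |excess u| := by
  unfold excess
  grind

theorem excess_sq_add_le (u v : ℝ) :
    excess (u + v) ^ 2 ≤ excess u ^ 2 + 2 * excess u * v + v ^ 2 := by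
  have := excess_sq_le (u + v) (c := u - excess u) (by unfold excess; grind)
    (by unfold excess; grind)
  linarith

theorem excess_sq_convex (u v : ℝ) {a b : ℝ} (ha : 0 ≤ a) (hb : 0 ≤ b) (hab : a + b = 1) :
    excess (a * u + b * v) ^ 2 ≤ a * excess u ^ 2 + b * excess v ^ 2 := by
  have hc : ∀ w, -1 ≤ w - excess w ∧ w - excess w ≤ 1 := fun w => by unfold excess; grind
  have h := excess_sq_le (a * u + b * v) (c := a * (u - excess u) + b * (v - excess v))
    (by nlinarith [hc u, hc v]) (by nlinarith [hc u, hc v])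
  have h2 : (a * excess u + b * excess v) ^ 2 ≤ a * excess u ^ 2 + b * excess v ^ 2 := by
    obtain rfl : b = 1 - a := by linarith
    nlinarith [mul_nonneg (mul_nonneg ha hb) (sq_nonneg (excess u - excess v))]
  calc _ ≤ _ := h
    _ = (a * excess u + b * excess v) ^ 2 := by ring
    _ ≤ _ := h2

/-- The summands of the energy functional. -/
noncomputable def energyTerm (x : NullSeq) (n : ℕ) : ℝ :=
  excess (x n) ^ 2 + (1 / 8) ^ n * form n x ^ 4

theorem energyTerm_nonneg (x : NullSeq) (n : ℕ) : 0 ≤ energyTerm x n := by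
  unfold energyTerm; positivity

theorem summable_eighth : Summable fun n : ℕ => (1 / 8 : ℝ) ^ n :=
  summable_geometric_of_lt_one (by norm_num) (by norm_num)

theorem summable_of_abs_le {u : ℕ → ℝ} {K : ℝ} (h : ∀ n, |u n| ≤ K) :
    Summable fun n => (1 / 8 : ℝ) ^ n * u n := by
  refine Summable.of_norm_bounded (summable_eighth.mul_right K) fun n => ?_
  rw [norm_mul, Real.norm_of_nonneg (by positivity), Real.norm_eq_abs]
  gcongr
  exact h n

theorem eventually_excess_eq_zero (x : NullSeq) : ∀ᶠ n in atTop, excess (x n) = 0 :=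
  (x.eventually_abs_lt one_pos).mono fun _ h => excess_eq_zero h.le

theorem summable_of_excess (x : NullSeq) {u : ℕ → ℝ} (h : ∀ n, excess (x n) = 0 → u n = 0) :
    Summable u := by
  obtain ⟨N, hN⟩ := eventually_atTop.1 (eventually_excess_eq_zero x)
  refine summable_of_ne_finset_zero (s := Finset.range N) fun n hn => h n (hN n ?_)
  simpa using hn

theorem summable_energyTerm (x : NullSeq) : Summable (energyTerm x) := by
  refine (summable_of_excess x (fun n h => by rw [h]; ring)).add
    (summable_of_abs_le (K := (4 * ‖x‖) ^ 4) fun n => ?_)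
  rw [abs_pow]
  gcongr
  exact abs_form_le n x

/-- The convex function whose unit sublevel set is the unit ball of the new norm. -/
noncomputable def energy (x : NullSeq) : ℝ := ∑' n, energyTerm x n

theorem energyTerm_convex (x y : NullSeq) {a b : ℝ} (ha : 0 ≤ a) (hb : 0 ≤ b) (hab : a + b = 1)
    (n : ℕ) : energyTerm (a • x + b • y) n ≤ a * energyTerm x n + b * energyTerm y n := by
  have h1 := excess_sq_convex (x n) (y n) ha hb hab
  have h2 : (a * form n x + b * form n y) ^ 4 ≤ a * form n x ^ 4 + b * form n y ^ 4 := by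
    have := (Even.convexOn_pow (n := 4) (𝕜 := ℝ) (by decide)).2 (mem_univ (form n x))
      (mem_univ (form n y)) ha hb hab
    simpa using this
  have h3 : (0 : ℝ) < (1 / 8) ^ n := by positivity
  unfold energyTerm
  simp only [ZeroAtInftyContinuousMap.add_apply, ZeroAtInftyContinuousMap.smul_apply, smul_eq_mul,
    map_add, map_smul]
  nlinarith [mul_le_mul_of_nonneg_left h2 h3.le]

theorem energy_convex (x y : NullSeq) {a b : ℝ} (ha : 0 ≤ a) (hb : 0 ≤ b) (hab : a + b = 1) :
    energy (a • x + b • y) ≤ a * energy x + b * energy y := by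
  unfold energy
  rw [← tsum_mul_left, ← tsum_mul_left,
    ← ((summable_energyTerm x).mul_left a).tsum_add ((summable_energyTerm y).mul_left b)]
  exact (summable_energyTerm _).tsum_le_tsum (energyTerm_convex x y ha hb hab)
    (((summable_energyTerm x).mul_left a).add ((summable_energyTerm y).mul_left b))

theorem energy_zero : energy 0 = 0 := by
  simp [energy, energyTerm, excess_eq_zero]

/-- The unit ball of the new norm. -/
def energyBall : Set NullSeq := {x | energy x ≤ 1}

theorem convex_energyBall : Convex ℝ energyBall := fun x hx y hy a b ha hb hab => by
  have := energy_convex x y ha hb hab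
  change energy x ≤ 1 at hx
  change energy y ≤ 1 at hy
  change energy _ ≤ 1
  nlinarith

theorem neg_mem_energyBall {x : NullSeq} (hx : x ∈ energyBall) : -x ∈ energyBall := by
  have : energy (-x) = energy x := by
    unfold energy energyTerm
    congr with n
    rw [map_neg, ZeroAtInftyContinuousMap.neg_apply, excess_neg]
    ring
  change energy _ ≤ 1
  rwa [this]

theorem isBounded_energyBall : Bornology.IsBounded energyBall := by
  refine isBounded_iff_forall_norm_le.2 ⟨2, fun x hx => norm_le zero_le_two fun n => ?_⟩
  have h1 : energyTerm x n ≤ 1 :=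
    ((summable_energyTerm x).le_tsum n fun _ _ => energyTerm_nonneg x _).trans hx
  have h2 : excess (x n) ^ 2 ≤ 1 := by
    have : 0 ≤ (1 / 8 : ℝ) ^ n * form n x ^ 4 := by positivity
    unfold energyTerm at h1
    linarith
  have h3 : |excess (x n)| ≤ 1 := (sq_le_one_iff_abs_le_one _).1 h2
  linarith [abs_le_one_add_abs_excess (x n)]

theorem energyBall_mem_nhds : energyBall ∈ 𝓝 (0 : NullSeq) := by
  refine Metric.mem_nhds_iff.2 ⟨1 / 16, by norm_num, fun x hx => ?_⟩
  rw [mem_ball_zero_iff] at hx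
  have hterm : ∀ n, energyTerm x n ≤ 1 / 2 * (1 / 2) ^ n := fun n => by
    have h1 : excess (x n) = 0 := excess_eq_zero (by linarith [x.abs_apply_le n])
    have h2 : |form n x| ≤ 1 / 2 := by linarith [abs_form_le n x]
    have h3 : form n x ^ 4 ≤ 1 / 2 := by
      have : |form n x| ^ 4 ≤ (1 / 2) ^ 4 := by gcongr
      rw [Even.pow_abs (by decide)] at this
      linarith
    have h4 : (1 / 8 : ℝ) ^ n ≤ (1 / 2) ^ n := by gcongr; norm_num
    have h5 : (1 / 8 : ℝ) ^ n * form n x ^ 4 ≤ (1 / 2) ^ n * (1 / 2) := by gcongr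
    rw [energyTerm, h1]
    linarith
  have := (summable_energyTerm x).tsum_le_tsum hterm (summable_geometric_two.mul_left _)
  rw [tsum_mul_left, tsum_geometric_two] at this
  change energy x ≤ 1
  unfold energy
  linarith

theorem continuous_energyTerm (n : ℕ) : Continuous fun x => energyTerm x n := by
  have h1 : Continuous fun x : NullSeq => x n :=
    (continuous_eval_const (F := BoundedContinuousFunction ℕ ℝ) n).comp
      ZeroAtInftyContinuousMap.isometry_toBCF.continuous
  have h2 : Continuous (form n) := AddMonoidHomClass.continuous_of_bound (form n) 4 (abs_form_le n)
  unfold energyTerm excess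
  exact ((h1.sub (continuous_const.max (continuous_const.min h1))).pow 2).add
    (continuous_const.mul (h2.pow 4))

theorem isClosed_energyBall : IsClosed energyBall := by
  have : energyBall = ⋂ s : Finset ℕ, {x | ∑ n ∈ s, energyTerm x n ≤ 1} := by
    ext x
    rw [mem_iInter]
    exact ⟨fun h s => ((summable_energyTerm x).sum_le_tsum s fun _ _ => energyTerm_nonneg x _).trans h,
      fun h => Real.tsum_le_of_sum_le (energyTerm_nonneg x) h⟩
  rw [this]
  exact isClosed_iInter fun s =>
    isClosed_le (continuous_finsetSum s fun n _ => continuous_energyTerm n) continuous_const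

theorem summable_excess_mul (x h : NullSeq) : Summable fun n => 2 * excess (x n) * h n :=
  summable_of_excess x fun n hn => by rw [hn]; ring

theorem summable_form_mul (x h : NullSeq) :
    Summable fun n => (1 / 8 : ℝ) ^ n * (4 * form n x ^ 3 * form n h) := by
  refine summable_of_abs_le (K := 4 * (4 * ‖x‖) ^ 3 * (4 * ‖h‖)) fun n => ?_
  rw [abs_mul, abs_mul, abs_pow, abs_of_pos (by norm_num : (0 : ℝ) < 4)]
  gcongr
  · exact abs_form_le n x
  · exact abs_form_le n h

/-- The Gateaux derivative of the energy. -/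
noncomputable def energyDeriv (x : NullSeq) : NullSeq →ₗ[ℝ] ℝ where
  toFun h := (∑' n, 2 * excess (x n) * h n) +
    ∑' n, (1 / 8 : ℝ) ^ n * (4 * form n x ^ 3 * form n h)
  map_add' h k := by
    rw [add_add_add_comm, ← (summable_excess_mul x h).tsum_add (summable_excess_mul x k),
      ← (summable_form_mul x h).tsum_add (summable_form_mul x k)]
    simp only [map_add, ZeroAtInftyContinuousMap.add_apply, mul_add]
  map_smul' c h := by
    simp only [map_smul, ZeroAtInftyContinuousMap.smul_apply, smul_eq_mul, RingHom.id_apply,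
      mul_add, ← tsum_mul_left]
    congr 2 <;> ext n <;> ring

theorem energyDeriv_apply (x h : NullSeq) : energyDeriv x h = (∑' n, 2 * excess (x n) * h n) +
    ∑' n, (1 / 8 : ℝ) ^ n * (4 * form n x ^ 3 * form n h) := rfl

theorem energyDeriv_neg (x : NullSeq) : energyDeriv (-x) = -energyDeriv x := by
  ext h
  rw [LinearMap.neg_apply, energyDeriv_apply, energyDeriv_apply, neg_add, ← tsum_neg, ← tsum_neg]
  simp only [map_neg, ZeroAtInftyContinuousMap.neg_apply, excess_neg]
  congr 2 <;> ext n <;> ring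

theorem energyDeriv_self_pos {x : NullSeq} (hx : x ≠ 0) : 0 < energyDeriv x x := by
  obtain ⟨k, hk⟩ : ∃ k, form k x ≠ 0 := by
    by_contra! h
    exact hx (eq_zero_of_forall_form_eq_zero h)
  have hq : ∀ n, (1 / 8 : ℝ) ^ n * (4 * form n x ^ 3 * form n x) =
      (1 / 8 : ℝ) ^ n * (4 * form n x ^ 4) := fun n => by ring
  refine add_pos_of_nonneg_of_pos (tsum_nonneg fun n => ?_)
    ((summable_form_mul x x).tsum_pos (fun n => ?_) k ?_)
  · linarith [excess_mul_self_nonneg (x n)]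
  · rw [hq]; positivity
  · rw [hq]
    have : 0 < form k x ^ 4 := (by decide : Even 4).pow_pos hk
    positivity

theorem quartic_add_le {u v t R : ℝ} (hu : |u| ≤ R) (hv : |v| ≤ R) (ht : |t| ≤ 1) :
    (u + t * v) ^ 4 ≤ u ^ 4 + t * (4 * u ^ 3 * v) + 11 * R ^ 4 * t ^ 2 := by
  have hR : 0 ≤ R := (abs_nonneg u).trans hu
  have h1 : u ^ 2 * v ^ 2 ≤ R ^ 2 * R ^ 2 := by
    rw [← sq_abs u, ← sq_abs v]; gcongr
  have h2 : t * (u * v ^ 3) ≤ 1 * (R * R ^ 3) := by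
    refine (le_abs_self _).trans ?_
    rw [abs_mul, abs_mul, abs_pow]
    gcongr
  have h3 : t ^ 2 * v ^ 4 ≤ 1 ^ 2 * R ^ 4 := by
    rw [← sq_abs t, ← Even.pow_abs (by decide : Even 4) v]; gcongr
  nlinarith [mul_le_mul_of_nonneg_left
    (by linarith : 6 * (u ^ 2 * v ^ 2) + 4 * (t * (u * v ^ 3)) + t ^ 2 * v ^ 4 ≤ 11 * R ^ 4)
    (sq_nonneg t)]

theorem energy_add_smul_le (x h : NullSeq) : ∃ C : ℝ, 0 ≤ C ∧ ∀ t : ℝ, |t| ≤ 1 →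
    energy (x + t • h) ≤ energy x + t * energyDeriv x h + C * t ^ 2 := by
  obtain ⟨N, hN⟩ := eventually_atTop.1
    ((x.eventually_abs_lt one_half_pos).and (h.eventually_abs_lt one_half_pos))
  set R := 4 * ‖x‖ + 4 * ‖h‖ with hR
  let c : ℕ → ℝ := fun n => (if n < N then h n ^ 2 else 0) + (1 / 8) ^ n * (11 * R ^ 4)
  have hc : Summable c :=
    (summable_of_ne_finset_zero (s := Finset.range N) fun n hn => if_neg (by simpa using hn)).add
      (summable_eighth.mul_right _)
  refine ⟨∑' n, c n, tsum_nonneg fun n => ?_, fun t ht => ?_⟩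
  · change 0 ≤ (if n < N then h n ^ 2 else 0) + (1 / 8) ^ n * (11 * R ^ 4)
    split_ifs <;> positivity
  have hd := (summable_excess_mul x h).add (summable_form_mul x h)
  rw [energyDeriv_apply, ← (summable_excess_mul x h).tsum_add (summable_form_mul x h), energy,
    energy, ← tsum_mul_left, ← tsum_mul_right,
    ← (summable_energyTerm x).tsum_add (hd.mul_left t),
    ← ((summable_energyTerm x).add (hd.mul_left t)).tsum_add (hc.mul_right (t ^ 2))]
  refine (summable_energyTerm _).tsum_le_tsum (fun n => ?_)
    (((summable_energyTerm x).add (hd.mul_left t)).add (hc.mul_right (t ^ 2)))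
  have h1 : form n (x + t • h) ^ 4 ≤
      form n x ^ 4 + t * (4 * form n x ^ 3 * form n h) + 11 * R ^ 4 * t ^ 2 := by
    rw [map_add, map_smul, smul_eq_mul]
    exact quartic_add_le (R := R) (by linarith [abs_form_le n x, norm_nonneg h])
      (by linarith [abs_form_le n h, norm_nonneg x]) ht
  have h2 : excess (x n + t * h n) ^ 2 ≤ excess (x n) ^ 2 + t * (2 * excess (x n) * h n) +
      (if n < N then h n ^ 2 else 0) * t ^ 2 := by
    split_ifs with hn
    · have := excess_sq_add_le (x n) (t * h n)
      linarith
    · obtain ⟨hx1, hh1⟩ := hN n (not_lt.1 hn)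
      have : |x n + t * h n| ≤ 1 := by
        have : |t| * |h n| ≤ 1 * |h n| := by gcongr
        refine (abs_add_le _ _).trans ?_
        rw [abs_mul]
        linarith
      rw [excess_eq_zero this, excess_eq_zero (by linarith)]
      simp
  have h3 := mul_le_mul_of_nonneg_left h1 (by positivity : (0 : ℝ) ≤ (1 / 8) ^ n)
  change excess (x n + t * h n) ^ 2 + (1 / 8) ^ n * form n (x + t • h) ^ 4 ≤
    excess (x n) ^ 2 + (1 / 8) ^ n * form n x ^ 4 + _ +
      ((if n < N then h n ^ 2 else 0) + (1 / 8) ^ n * (11 * R ^ 4)) * t ^ 2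
  linarith

theorem eq_zero_of_mul_le_mul_sq {p K : ℝ} (h : ∀ t : ℝ, |t| ≤ 1 → t * p ≤ K * t ^ 2) :
    p = 0 := by
  have hK : 0 ≤ K := by
    have h1 := h 1 (by simp)
    have h2 := h (-1) (by simp)
    linarith
  have key : ∀ q : ℝ, (∀ t : ℝ, |t| ≤ 1 → t * q ≤ K * t ^ 2) → q ≤ 0 := fun q hq => by
    by_contra! hpos
    have hs : 0 < q + K + 1 := by linarith
    have ht0 : 0 < q / (2 * (q + K + 1)) := by positivity
    have ht1 : q / (2 * (q + K + 1)) ≤ 1 := by rw [div_le_one (by positivity)]; linarith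
    have h1 := hq _ (by rw [abs_of_pos ht0]; exact ht1)
    rw [sq, mul_left_comm, mul_le_mul_iff_right₀ ht0, mul_div_assoc', le_div_iff₀ (by positivity)]
      at h1
    nlinarith
  refine le_antisymm (key p h) ?_
  have := key (-p) fun t ht => by
    have := h (-t) (by rwa [abs_neg])
    linarith
  linarith

/-- A functional whose modulus is maximal on the energy ball at `x` is a multiple of the derivative
of the energy at `x`. -/
theorem exists_eq_smul_energyDeriv {x : NullSeq} (hx : x ∈ energyBall) (f : NullSeq →ₗ[ℝ] ℝ)
    (hf : ∀ y ∈ energyBall, |f y| ≤ |f x|) : ∃ c : ℝ, f = c • energyDeriv x := by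
  have hker : ∀ h, energyDeriv x h = 0 → f h = 0 := by
    intro h hh
    obtain ⟨C, hC, hCt⟩ := energy_add_smul_le x h
    have hsq : ∀ t : ℝ, |t| ≤ 1 → (f x + t * f h) ^ 2 ≤ (f x) ^ 2 * (1 + C * t ^ 2) ^ 2 := by
      intro t ht
      have hs : 0 < 1 + C * t ^ 2 := by positivity
      have hmem : (1 + C * t ^ 2)⁻¹ • (x + t • h) ∈ energyBall := by
        have h1 := energy_convex (x + t • h) 0 (a := (1 + C * t ^ 2)⁻¹)
          (b := 1 - (1 + C * t ^ 2)⁻¹) (by positivity)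
          (sub_nonneg.2 (inv_le_one_of_one_le₀ (by nlinarith [sq_nonneg t]))) (by ring)
        rw [smul_zero, add_zero, energy_zero, mul_zero, add_zero] at h1
        refine h1.trans ?_
        rw [inv_mul_le_iff₀ hs, mul_one]
        have h2 := hCt t ht
        have h3 : energy x ≤ 1 := hx
        rw [hh] at h2
        linarith
      have h1 := hf _ hmem
      rw [map_smul, map_add, map_smul, smul_eq_mul, smul_eq_mul, abs_mul, abs_inv, abs_of_pos hs,
        inv_mul_le_iff₀ hs] at h1
      have h2 := pow_le_pow_left₀ (abs_nonneg _) h1 2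
      rw [sq_abs, mul_pow, sq_abs] at h2
      linarith
    have hprod : f x * f h = 0 := by
      refine eq_zero_of_mul_le_mul_sq (K := (f x) ^ 2 * (2 * C + C ^ 2)) fun t ht => ?_
      have h1 := hsq t ht
      have h2 : t ^ 2 ≤ 1 := (sq_le_one_iff_abs_le_one t).2 ht
      have h3 : 0 ≤ (f x) ^ 2 * C ^ 2 * t ^ 2 * (1 - t ^ 2) :=
        mul_nonneg (by positivity) (by linarith)
      have h4 : 0 ≤ (f x) ^ 2 * (2 * C + C ^ 2) * t ^ 2 := by positivity
      nlinarith [sq_nonneg (t * f h)]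
    rcases mul_eq_zero.1 hprod with h0 | h0
    · have := hsq 1 (by simp)
      rw [h0] at this
      have h1 : f h ^ 2 ≤ 0 := by linarith
      exact pow_eq_zero_iff two_ne_zero |>.1 (le_antisymm h1 (sq_nonneg _))
    · exact h0
  rcases eq_or_ne x 0 with rfl | hx0
  · refine ⟨0, ?_⟩
    ext h
    rw [zero_smul, LinearMap.zero_apply]
    exact hker h (by simp [energyDeriv_apply, excess_eq_zero])
  · have hpos := energyDeriv_self_pos hx0
    refine ⟨f x / energyDeriv x x, ?_⟩
    ext h
    have := hker (energyDeriv x x • h - energyDeriv x h • x) (by simp; ring)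
    rw [map_sub, map_smul, map_smul, smul_eq_mul, smul_eq_mul] at this
    rw [LinearMap.smul_apply, smul_eq_mul]
    field_simp
    linarith

theorem energyDeriv_single {x : NullSeq} {b : ℕ} (h : excess (x b) = 0) :
    energyDeriv x (single b) = ∑' n, (1 / 8 : ℝ) ^ n * (4 * form n x ^ 3 * form n (single b)) := by
  rw [energyDeriv_apply, add_eq_right]
  refine (tsum_congr fun n => ?_).trans tsum_zero
  rw [single_apply]
  split_ifs with hn
  · rw [hn, h]; ring
  · ring

/-- A linear relation between three derivatives of the energy forces any two of the points with
nonzero coefficients to be proportional. -/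
theorem mul_eq_mul_of_energyDeriv_relation {x y z : NullSeq} {a b c : ℝ} (ha : a ≠ 0) (hb : b ≠ 0)
    (h : a • energyDeriv x + b • energyDeriv y + c • energyDeriv z = 0) (j k : ℕ) :
    x j * y k = x k * y j := by
  let d : ℕ → ℝ := fun n => 4 * (a * form n x ^ 3 + b * form n y ^ 3 + c * form n z ^ 3)
  have hd : ∀ n, |d n| ≤ 4 * (|a| * (4 * ‖x‖) ^ 3 + |b| * (4 * ‖y‖) ^ 3 + |c| * (4 * ‖z‖) ^ 3) := by
    intro n
    rw [abs_mul, abs_of_pos (by norm_num : (0 : ℝ) < 4)]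
    gcongr
    refine (abs_add_three _ _ _).trans ?_
    rw [abs_mul, abs_mul, abs_mul, abs_pow, abs_pow, abs_pow]
    gcongr <;> exact abs_form_le n _
  have hev : ∀ᶠ m in atTop, ∑' n, (1 / 8 : ℝ) ^ n * (d n * form n (single m)) = 0 := by
    filter_upwards [eventually_excess_eq_zero x, eventually_excess_eq_zero y,
      eventually_excess_eq_zero z] with m hx hy hz
    have h1 := LinearMap.congr_fun h (single m)
    simp only [LinearMap.add_apply, LinearMap.smul_apply, LinearMap.zero_apply, smul_eq_mul,
      energyDeriv_single hx, energyDeriv_single hy, energyDeriv_single hz] at h1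
    have sx := (summable_form_mul x (single m)).mul_left a
    have sy := (summable_form_mul y (single m)).mul_left b
    have sz := (summable_form_mul z (single m)).mul_left c
    rw [← tsum_mul_left, ← tsum_mul_left, ← tsum_mul_left, ← sx.tsum_add sy,
      ← (sx.add sy).tsum_add sz] at h1
    rw [← h1]
    refine tsum_congr fun n => ?_
    ring
  refine mul_eq_mul_of_cubic_relation ha hb (c := c) (z := z) (fun n => ?_) j k
  have := coeff_eq_zero_of_eventually_tsum_eq_zero hd hev n
  linarith

theorem exists_eq_smul_of_energyDeriv_relation {x y z : NullSeq} {a b c : ℝ} (ha : a ≠ 0)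
    (hb : b ≠ 0) (hy : y ≠ 0)
    (h : a • energyDeriv x + b • energyDeriv y + c • energyDeriv z = 0) :
    ∃ r : ℝ, x = r • y := by
  obtain ⟨k, hk⟩ : ∃ k, y k ≠ 0 := by
    by_contra! h0
    exact hy (by ext n; simpa using h0 n)
  refine ⟨x k / y k, ?_⟩
  ext j
  have := mul_eq_mul_of_energyDeriv_relation ha hb h j k
  rw [ZeroAtInftyContinuousMap.smul_apply, smul_eq_mul]
  field_simp
  linarith

end NullSeq

section DerivativeMap

variable {X : Type*} [NormedAddCommGroup X] [NormedSpace ℝ X] {D : X → X →ₗ[ℝ] ℝ}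

/-- If norm-attaining functionals are multiples of the values of a map `D` whose values satisfy only
trivial linear relations, then proper convex combinations of independent norm-attaining functionals
do not attain their norm. -/
theorem not_normAttaining_segment
    (hatt : ∀ (f : X →L[ℝ] ℝ) (x : X), ‖x‖ = 1 → |f x| = ‖f‖ →
      ∃ c : ℝ, f.toLinearMap = c • D x)
    (hneg : ∀ x, D (-x) = -D x)
    (hdep : ∀ (x y z : X) (a b c : ℝ), ‖x‖ = 1 → ‖y‖ = 1 → a ≠ 0 → b ≠ 0 →
      a • D x + b • D y + c • D z = 0 → x = y ∨ x = -y)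
    (f g : X →L[ℝ] ℝ) (hf : ∃ x : X, ‖x‖ = 1 ∧ |f x| = ‖f‖)
    (hg : ∃ x : X, ‖x‖ = 1 ∧ |g x| = ‖g‖) (hfg : LinearIndependent ℝ ![f, g])
    (t : ℝ) (ht0 : 0 < t) (ht1 : t < 1) :
    ¬ ∃ x : X, ‖x‖ = 1 ∧ |(t • f + (1 - t) • g) x| = ‖t • f + (1 - t) • g‖ := by
  rintro ⟨z, hz, hhz⟩
  obtain ⟨x, hx, hfx⟩ := hf
  obtain ⟨y, hy, hgy⟩ := hg
  obtain ⟨a, ha⟩ := hatt f x hx hfx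
  obtain ⟨b, hb⟩ := hatt g y hy hgy
  obtain ⟨c, hc⟩ := hatt _ z hz hhz
  rw [LinearIndependent.pair_iff] at hfg
  have ha0 : a ≠ 0 := by
    rintro rfl
    have hf0 : f = 0 := ContinuousLinearMap.coe_injective (by simpa using ha)
    simpa using hfg 1 0 (by simp [hf0])
  have hb0 : b ≠ 0 := by
    rintro rfl
    have hg0 : g = 0 := ContinuousLinearMap.coe_injective (by simpa using hb)
    simpa using hfg 0 1 (by simp [hg0])
  have hrel : (t * a) • D x + ((1 - t) * b) • D y + (-c) • D z = 0 := by
    rw [mul_smul, mul_smul, ← ha, ← hb]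
    ext v
    have := LinearMap.congr_fun hc v
    simp at this ⊢
    linarith
  have hlin : ∃ r : ℝ, D x = r • D y := by
    rcases hdep x y z _ _ _ hx hy (mul_ne_zero ht0.ne' ha0)
      (mul_ne_zero (by linarith) hb0) hrel with h | h
    · exact ⟨1, by simp [h]⟩
    · exact ⟨-1, by ext v; simp [h, hneg]⟩
  obtain ⟨r, hr⟩ := hlin
  have hzero : b • f + (-(a * r)) • g = 0 := by
    apply ContinuousLinearMap.coe_injective
    change b • f.toLinearMap + (-(a * r)) • g.toLinearMap = 0
    rw [ha, hb, hr]
    module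
  exact hb0 (hfg _ _ hzero).1

/-- Under the same assumptions, at most two points up to sign of the unit sphere of a quotient of
dimension two lift to the unit ball. -/
theorem codim_two_quotient_sphere
    (hatt : ∀ (f : X →L[ℝ] ℝ) (x : X), ‖x‖ = 1 → |f x| = ‖f‖ →
      ∃ c : ℝ, f.toLinearMap = c • D x)
    (hne : ∀ x, ‖x‖ = 1 → D x ≠ 0)
    (hdep : ∀ (x y z : X) (a b c : ℝ), ‖x‖ = 1 → ‖y‖ = 1 → a ≠ 0 → b ≠ 0 →
      a • D x + b • D y + c • D z = 0 → x = y ∨ x = -y)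
    (M : Submodule ℝ X) (hM : IsClosed (M : Set X)) (hdim : Module.finrank ℝ (X ⧸ M) = 2) :
    ∃ x₁ x₂ : X, ‖x₁‖ ≤ 1 ∧ ‖x₂‖ ≤ 1 ∧
      {q : X ⧸ M | ∃ x : X, ‖x‖ ≤ 1 ∧ Metric.infDist x (M : Set X) = 1 ∧
          q = Submodule.Quotient.mk x} ⊆
        {Submodule.Quotient.mk x₁, Submodule.Quotient.mk x₂,
          -Submodule.Quotient.mk x₁, -Submodule.Quotient.mk x₂} := by
  have hfin : FiniteDimensional ℝ (X ⧸ M) := Module.finite_of_finrank_eq_succ hdim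
  let S : Set X := {x | ‖x‖ ≤ 1 ∧ Metric.infDist x (M : Set X) = 1}
  have hS : ∀ x ∈ S, ‖x‖ = 1 ∧ ∃ φ : Module.Dual ℝ (X ⧸ M), D x = φ ∘ₗ M.mkQ := by
    rintro x ⟨hx1, hxd⟩
    have hq : ‖(Submodule.Quotient.mk x : X ⧸ M)‖ = 1 := by
      rw [← hxd]; exact QuotientAddGroup.norm_mk x (S := M.toAddSubgroup)
    obtain ⟨φ, hφ, hφx⟩ := exists_dual_vector ℝ (Submodule.Quotient.mk x : X ⧸ M)
      (by rw [hq]; exact one_ne_zero)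
    have hle : ∀ y, |φ (Submodule.Quotient.mk y)| ≤ 1 * ‖y‖ := fun y => by
      have h1 := φ.le_opNorm (Submodule.Quotient.mk y)
      rw [hφ] at h1
      exact h1.trans (by
        gcongr
        exact Submodule.Quotient.norm_mk_le M y)
    let f : X →L[ℝ] ℝ := (φ.toLinearMap ∘ₗ M.mkQ).mkContinuous 1 hle
    have hfx : f x = 1 := by
      change φ (Submodule.Quotient.mk x) = 1
      rw [hφx, hq]; rfl
    have hf1 : ‖f‖ ≤ 1 := LinearMap.mkContinuous_norm_le _ zero_le_one _
    have hfx' : ‖f x‖ ≤ ‖f‖ * ‖x‖ := f.le_opNorm x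
    rw [hfx, norm_one] at hfx'
    have hx : ‖x‖ = 1 := by nlinarith [norm_nonneg x, norm_nonneg f]
    rw [hx, mul_one] at hfx'
    obtain ⟨c, hc⟩ := hatt f x hx (by rw [hfx, abs_one]; linarith)
    have hc0 : c ≠ 0 := by
      rintro rfl
      have := LinearMap.congr_fun hc x
      simp [hfx] at this
    refine ⟨hx, c⁻¹ • φ.toLinearMap, ?_⟩
    rw [LinearMap.smul_comp, eq_inv_smul_iff₀ hc0, ← hc]
    rfl
  have htriple : ∀ x ∈ S, ∀ y ∈ S, ∀ z ∈ S,
      (x = y ∨ x = -y) ∨ (x = z ∨ x = -z) ∨ (y = z ∨ y = -z) := by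
    intro x hx y hy z hz
    obtain ⟨hx1, φ, hφ⟩ := hS x hx
    obtain ⟨hy1, ψ, hψ⟩ := hS y hy
    obtain ⟨hz1, χ, hχ⟩ := hS z hz
    have hnot : ¬ LinearIndependent ℝ ![φ, ψ, χ] := fun h => by
      have := h.fintype_card_le_finrank
      rw [Subspace.dual_finrank_eq, hdim] at this
      simp at this
    obtain ⟨c, hc, i, hi⟩ := Fintype.not_linearIndependent_iff.1 hnot
    have hrel : c 0 • D x + c 1 • D y + c 2 • D z = 0 := by
      have := congrArg (fun θ : Module.Dual ℝ (X ⧸ M) => θ ∘ₗ M.mkQ) hc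
      simpa [Fin.sum_univ_three, hφ, hψ, hχ, LinearMap.add_comp, LinearMap.smul_comp] using this
    by_cases h0 : c 0 = 0
    · by_cases h1 : c 1 = 0
      · have h2 : c 2 ≠ 0 := by fin_cases i <;> simp_all
        simp [h0, h1, h2, hne z hz1] at hrel
      · by_cases h2 : c 2 = 0
        · simp [h0, h1, h2, hne y hy1] at hrel
        · exact Or.inr (Or.inr (hdep y z x _ _ _ hy1 hz1 h1 h2 (by rw [← hrel]; abel)))
    · by_cases h1 : c 1 = 0
      · by_cases h2 : c 2 = 0
        · simp [h0, h1, h2, hne x hx1] at hrel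
        · exact Or.inr (Or.inl (hdep x z y _ _ _ hx1 hz1 h0 h2 (by rw [← hrel]; abel)))
      · exact Or.inl (hdep x y z _ _ _ hx1 hy1 h0 h1 hrel)
  have hcover : ∃ x₁ x₂ : X, ‖x₁‖ ≤ 1 ∧ ‖x₂‖ ≤ 1 ∧
      ∀ x ∈ S, x = x₁ ∨ x = x₂ ∨ x = -x₁ ∨ x = -x₂ := by
    rcases S.eq_empty_or_nonempty with hE | ⟨x₁, hx₁⟩
    · exact ⟨0, 0, by simp, by simp, by simp [hE]⟩
    · by_cases h : ∃ x₂ ∈ S, x₂ ≠ x₁ ∧ x₂ ≠ -x₁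
      · obtain ⟨x₂, hx₂, hn⟩ := h
        refine ⟨x₁, x₂, hx₁.1, hx₂.1, fun x hx => ?_⟩
        have := htriple x₂ hx₂ x₁ hx₁ x hx
        grind
      · push Not at h
        refine ⟨x₁, x₁, hx₁.1, hx₁.1, fun x hx => ?_⟩
        have := h x hx
        tauto
  obtain ⟨x₁, x₂, h₁, h₂, hcov⟩ := hcover
  refine ⟨x₁, x₂, h₁, h₂, ?_⟩
  rintro q ⟨x, hx, hxd, rfl⟩
  rcases hcov x ⟨hx, hxd⟩ with rfl | rfl | rfl | rfl <;> simp

end DerivativeMap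


/-- There is an infinite-dimensional real Banach space `X` such that (i) the norm-attaining
segment property holds, and (ii) for every closed subspace `M` of codimension two there are
`x₁, x₂` in the closed unit ball with `π_M(B_X) ∩ S_{X/M} ⊆ {±π_M(x₁), ±π_M(x₂)}`, where the
quotient norm of `π_M(x)` is `dist(x, M)`. -/
theorem statement8 :
    ∃ (X : Type) (_ : NormedAddCommGroup X) (_ : NormedSpace ℝ X) (_ : CompleteSpace X),
      ¬ FiniteDimensional ℝ X ∧
      (∀ f g : X →L[ℝ] ℝ,
        (∃ x : X, ‖x‖ = 1 ∧ |f x| = ‖f‖) →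
        (∃ x : X, ‖x‖ = 1 ∧ |g x| = ‖g‖) →
        LinearIndependent ℝ ![f, g] →
        ∀ t : ℝ, 0 < t → t < 1 →
          ¬ ∃ x : X, ‖x‖ = 1 ∧ |(t • f + (1 - t) • g) x| = ‖t • f + (1 - t) • g‖) ∧
      (∀ M : Submodule ℝ X, IsClosed (M : Set X) → Module.finrank ℝ (X ⧸ M) = 2 →
        ∃ x₁ x₂ : X, ‖x₁‖ ≤ 1 ∧ ‖x₂‖ ≤ 1 ∧
          {q : X ⧸ M | ∃ x : X, ‖x‖ ≤ 1 ∧ Metric.infDist x (M : Set X) = 1 ∧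
              q = Submodule.Quotient.mk x} ⊆
            {Submodule.Quotient.mk x₁, Submodule.Quotient.mk x₂,
              -Submodule.Quotient.mk x₁, -Submodule.Quotient.mk x₂}) := by
  obtain ⟨X, iN, iS, iC, e, he⟩ := exists_complete_gauge_norm NullSeq.convex_energyBall
    (fun _ => NullSeq.neg_mem_energyBall) NullSeq.isBounded_energyBall NullSeq.energyBall_mem_nhds
  let D : X → X →ₗ[ℝ] ℝ := fun x => NullSeq.energyDeriv (e.symm x) ∘ₗ e.symm.toLinearMap
  have hnorm : ∀ x, ‖e x‖ ≤ 1 ↔ x ∈ NullSeq.energyBall := fun x => by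
    rw [he, gauge_le_one_iff_mem_closure NullSeq.convex_energyBall NullSeq.energyBall_mem_nhds,
      NullSeq.isClosed_energyBall.closure_eq]
  have hsymm0 : ∀ x : X, ‖x‖ = 1 → e.symm x ≠ 0 := fun x hx h => by
    rw [e.symm.map_eq_zero_iff.1 h, norm_zero] at hx
    exact zero_ne_one hx
  have hatt : ∀ (f : X →L[ℝ] ℝ) (x : X), ‖x‖ = 1 → |f x| = ‖f‖ →
      ∃ c : ℝ, f.toLinearMap = c • D x := by
    intro f x hx hfx
    obtain ⟨c, hc⟩ := NullSeq.exists_eq_smul_energyDeriv (x := e.symm x)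
      ((hnorm _).1 (by rw [e.apply_symm_apply, hx])) (f.toLinearMap ∘ₗ e.toLinearMap)
      fun y hy => by
        have h1 : ‖f (e y)‖ ≤ ‖f‖ * ‖e y‖ := f.le_opNorm (e y)
        have h2 : ‖f‖ * ‖e y‖ ≤ ‖f‖ * 1 := by gcongr; exact (hnorm y).2 hy
        simpa [hfx] using h1.trans h2
    refine ⟨c, ?_⟩
    ext v
    simpa [D] using LinearMap.congr_fun hc (e.symm v)
  have hneg : ∀ x, D (-x) = -D x := fun x => by
    ext v
    simp [D, NullSeq.energyDeriv_neg]
  have hne : ∀ x, ‖x‖ = 1 → D x ≠ 0 := fun x hx h =>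
    (NullSeq.energyDeriv_self_pos (hsymm0 x hx)).ne' (LinearMap.congr_fun h x)
  have hdep : ∀ (x y z : X) (a b c : ℝ), ‖x‖ = 1 → ‖y‖ = 1 → a ≠ 0 → b ≠ 0 →
      a • D x + b • D y + c • D z = 0 → x = y ∨ x = -y := by
    intro x y z a b c hx hy ha hb hrel
    obtain ⟨r, hr⟩ := NullSeq.exists_eq_smul_of_energyDeriv_relation (x := e.symm x)
      (y := e.symm y) (z := e.symm z) (c := c) ha hb (hsymm0 y hy) (by
        ext v
        simpa [D] using LinearMap.congr_fun hrel (e v))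
    rw [← map_smul, e.symm.injective.eq_iff] at hr
    have hr1 : |r| = 1 := by
      rw [hr, norm_smul, hy, mul_one] at hx
      exact hx
    rcases eq_or_eq_neg_of_abs_eq hr1 with rfl | rfl
    · exact Or.inl (by rw [hr, one_smul])
    · exact Or.inr (by rw [hr, neg_one_smul])
  exact ⟨X, iN, iS, iC,
    fun h => NullSeq.not_finiteDimensional (e.symm.finiteDimensional),
    not_normAttaining_segment hatt hneg hdep, codim_two_quotient_sphere hatt hne hdep⟩
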